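/- Fix δ > 0, ρ > 0 and λ > 0. The function f(a) := δρ(τ_a² − 1) + δρ²τ_a²/γ_a² + λa² attains a unique minimizer a* over [0,∞), and this minimizer satisfies a* > 0. -/

import Mathlib

noncomputable section
open MeasureTheory ProbabilityTheory Filter
open scoped ENNReal NNReal

/-- The standard real Gaussian measure `N(0,1)`. -/
def stdGaussian : Measure ℝ := gaussianReal 0 1

/-- The denoiser `η_a(x; γ) = P_{[-a,a]}(x/(1+γ))`. -/
def eta (a γ x : ℝ) : ℝ := max (-a) (min a (x / (1 + γ)))

/-- The derivative of the denoiser in `x` (defined except at `|x| = a(1+γ)`). -/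
def eta' (a γ x : ℝ) : ℝ := if |x| < a * (1 + γ) then 1 / (1 + γ) else 0

/-- `(τ², γ)` solves the state-evolution fixed-point equations for parameters `(δ, ρ, a)`:
`τ² = 1 + δ⁻¹ E[η_a(τZ; γ)²]` and `ρ = γ (1 − δ⁻¹ E[η_a'(τZ; γ)])`, with `τ² ≥ 1, γ > 0`. -/
def IsSEFixedPoint (δ ρ a : ℝ) (p : ℝ × ℝ) : Prop :=
  1 ≤ p.1 ∧ 0 < p.2 ∧
    p.1 = 1 + δ⁻¹ * ∫ z, (eta a p.2 (Real.sqrt p.1 * z)) ^ 2 ∂stdGaussian ∧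
    ρ = p.2 * (1 - δ⁻¹ * ∫ z, eta' a p.2 (Real.sqrt p.1 * z) ∂stdGaussian)

/-- The limiting objective `f(a) = δρ(τ_a² − 1) + δρ²τ_a²/γ_a² + λa²`, expressed in terms of
functions `a ↦ τ_a²` and `a ↦ γ_a`. -/
def fLim (δ ρ lam : ℝ) (τ2 γv : ℝ → ℝ) (a : ℝ) : ℝ :=
  δ * ρ * (τ2 a - 1) + δ * ρ ^ 2 * τ2 a / (γv a) ^ 2 + lam * a ^ 2

instance isProbabilityMeasure_stdGaussian : IsProbabilityMeasure stdGaussian := by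
  unfold _root_.stdGaussian; infer_instance

lemma abs_eta_le {a : ℝ} (ha : 0 ≤ a) (γ x : ℝ) : |eta a γ x| ≤ a := by
  unfold eta
  rw [abs_le]
  exact ⟨le_max_left _ _, max_le (by linarith) (min_le_left _ _)⟩

lemma continuous_eta (a γ : ℝ) : Continuous (eta a γ) := by
  unfold eta
  fun_prop

lemma measurable_eta' (a γ : ℝ) : Measurable (eta' a γ) := by
  unfold eta'
  exact Measurable.ite (measurableSet_lt (by fun_prop) (by fun_prop)) measurable_const
    measurable_const

lemma integrable_id_stdGaussian : Integrable (fun z : ℝ => z) stdGaussian :=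
  memLp_one_iff_integrable.1 (memLp_id_gaussianReal 1)

lemma integrable_of_abs_le {Y : ℝ → ℝ} {b : ℝ} (hY : Measurable Y) (hb : ∀ z, |Y z| ≤ b) :
    Integrable Y stdGaussian :=
  Integrable.of_bound hY.aestronglyMeasurable b (ae_of_all _ hb)

lemma integrable_mul_of_abs_le {Y W : ℝ → ℝ} {b : ℝ} (hY : Measurable Y) (hb : ∀ z, |Y z| ≤ b)
    (hW : Integrable W stdGaussian) : Integrable (fun z => W z * Y z) stdGaussian :=
  hW.mul_bdd hY.aestronglyMeasurable (ae_of_all _ hb)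

lemma hasDerivAt_gaussianPDFReal_std (z : ℝ) :
    HasDerivAt (gaussianPDFReal 0 1) (-z * gaussianPDFReal 0 1 z) z := by
  have h : HasDerivAt (fun x : ℝ => -(x - 0) ^ 2 / (2 * ((1 : ℝ≥0) : ℝ))) (-z) z := by
    have := ((((hasDerivAt_id z).sub_const 0).pow 2).neg).div_const (2 * ((1 : ℝ≥0) : ℝ))
    refine this.congr_deriv ?_
    simp
    ring
  have h2 := (h.exp).const_mul (√(2 * Real.pi * ((1 : ℝ≥0) : ℝ)))⁻¹
  refine h2.congr_deriv ?_
  simp only [gaussianPDFReal]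
  ring

lemma tendsto_gaussianPDFReal_std_atTop :
    Tendsto (gaussianPDFReal 0 1) atTop (nhds 0) := by
  have h : Tendsto (fun x : ℝ => -(x - 0) ^ 2 / (2 * ((1 : ℝ≥0) : ℝ))) atTop atBot := by
    have h1 : Tendsto (fun x : ℝ => x ^ 2 / 2) atTop atTop :=
      (tendsto_pow_atTop two_ne_zero).atTop_div_const two_pos
    refine (tendsto_neg_atTop_atBot.comp h1).congr fun x => ?_
    simp [neg_div]
  have h2 := (Real.tendsto_exp_atBot.comp h).const_mul (√(2 * Real.pi * ((1 : ℝ≥0) : ℝ)))⁻¹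
  rw [mul_zero] at h2
  exact h2

lemma gaussianPDFReal_std_neg (z : ℝ) : gaussianPDFReal 0 1 (-z) = gaussianPDFReal 0 1 z := by
  simp [gaussianPDFReal]

lemma integral_stdGaussian (f : ℝ → ℝ) :
    ∫ z, f z ∂stdGaussian = ∫ z, gaussianPDFReal 0 1 z * f z := by
  simpa [_root_.stdGaussian] using
    integral_gaussianReal_eq_integral_smul (f := f) (μ := 0) (v := 1) one_ne_zero

lemma integrable_gaussianPDFReal_mul {f : ℝ → ℝ} (hf : Integrable f stdGaussian) :
    Integrable (fun z => gaussianPDFReal 0 1 z * f z) := by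
  unfold _root_.stdGaussian at hf
  rw [gaussianReal_of_var_ne_zero _ one_ne_zero,
    integrable_withDensity_iff_integrable_smul' (measurable_gaussianPDF 0 1)
      (ae_of_all _ fun _ => gaussianPDF_lt_top)] at hf
  simpa [toReal_gaussianPDF] using hf

lemma hasDerivAt_eta {a γ x : ℝ} (hγ : 0 < 1 + γ) (hx : |x| ≠ a * (1 + γ)) (ha : 0 ≤ a) :
    HasDerivAt (eta a γ) (eta' a γ x) x := by
  rcases lt_or_gt_of_ne hx with h | h
  · have hev : eta a γ =ᶠ[nhds x] fun y => y / (1 + γ) := by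
      filter_upwards [continuous_abs.continuousAt.eventually_lt continuousAt_const h] with y hy
      rw [abs_lt] at hy
      have h1 : y / (1 + γ) ≤ a := by rw [div_le_iff₀ hγ]; exact hy.2.le
      have h2 : -a ≤ y / (1 + γ) := by rw [le_div_iff₀ hγ]; linarith [hy.1]
      simp [eta, min_eq_right h1, max_eq_right h2]
    rw [eta', if_pos h]
    exact ((hasDerivAt_id x).div_const (1 + γ)).congr_of_eventuallyEq hev
  · rw [eta', if_neg h.not_gt]
    rcases lt_abs.1 h with h | h
    · have hev : eta a γ =ᶠ[nhds x] fun _ => a := by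
        filter_upwards [lt_mem_nhds h] with y hy
        have h1 : a ≤ y / (1 + γ) := by rw [le_div_iff₀ hγ]; exact hy.le
        simp [eta, min_eq_left h1]
        linarith
      exact (hasDerivAt_const x a).congr_of_eventuallyEq hev
    · have hev : eta a γ =ᶠ[nhds x] fun _ => -a := by
        filter_upwards [gt_mem_nhds (show x < -(a * (1 + γ)) by linarith)] with y hy
        have h1 : y / (1 + γ) ≤ -a := by rw [div_le_iff₀ hγ]; linarith
        simp [eta, h1]
      exact (hasDerivAt_const x (-a)).congr_of_eventuallyEq hev

/-- Gaussian integration by parts for the denoiser. -/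
lemma integral_mul_eta {a γ t : ℝ} (ha : 0 ≤ a) (hγ : 0 < 1 + γ) (ht : 0 < t) :
    ∫ z, z * eta a γ (t * z) ∂stdGaussian = t * ∫ z, eta' a γ (t * z) ∂stdGaussian := by
  have hX : Measurable fun z => eta a γ (t * z) :=
    (continuous_eta a γ).measurable.comp (by fun_prop)
  have hX' : Measurable fun z => eta' a γ (t * z) := (measurable_eta' a γ).comp (by fun_prop)
  have hi1 : Integrable (fun z => z * eta a γ (t * z)) stdGaussian :=
    integrable_mul_of_abs_le hX (fun z => abs_eta_le ha γ _) integrable_id_stdGaussian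
  have hi2 : Integrable (fun z => eta' a γ (t * z)) stdGaussian := by
    refine integrable_of_abs_le hX' (b := 1 / (1 + γ)) fun z => ?_
    have : 0 < 1 / (1 + γ) := by positivity
    unfold eta'
    split_ifs
    · rw [abs_of_pos this]
    · simpa using this.le
  have hi := hi1.sub (hi2.const_mul t)
  rw [← sub_eq_zero, ← integral_const_mul, ← integral_sub hi1 (hi2.const_mul t),
    integral_stdGaussian]
  have hi' := integrable_gaussianPDFReal_mul hi
  have hlim := intervalIntegral_tendsto_integral hi' tendsto_neg_atTop_atBot tendsto_id
  refine tendsto_nhds_unique hlim ?_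
  set H : ℝ → ℝ := fun z => -(eta a γ (t * z) * gaussianPDFReal 0 1 z) with hH
  have hHc : Continuous H := by
    have h1 := continuous_eta a γ
    have h2 : Continuous (gaussianPDFReal 0 1) :=
      continuous_iff_continuousAt.2 fun z => (hasDerivAt_gaussianPDFReal_std z).continuousAt
    fun_prop
  have hFTC : ∀ R : ℝ, ∫ z in (-R)..R, gaussianPDFReal 0 1 z *
      ((fun z => z * eta a γ (t * z)) - fun z => t * eta' a γ (t * z)) z = H R - H (-R) := by
    intro R
    refine integral_eq_of_hasDerivAt_off_countable H _
      (s := {a * (1 + γ) / t, -(a * (1 + γ) / t)}) (Set.toFinite _).countable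
      hHc.continuousOn (fun z hz => ?_) hi'.intervalIntegrable
    have hne : |t * z| ≠ a * (1 + γ) := by
      intro h
      refine hz.2 ?_
      have h0 : |z| = a * (1 + γ) / t := by
        rw [abs_mul, abs_of_pos ht] at h
        rw [← h]; field_simp
      rcases abs_choice z with h1 | h1
      · left; linarith
      · right; simp only [Set.mem_singleton_iff]; linarith
    have hd := (((hasDerivAt_eta hγ hne ha).comp z ((hasDerivAt_id z).const_mul t)).mul
      (hasDerivAt_gaussianPDFReal_std z)).neg
    refine hd.congr_deriv ?_
    simp only [Pi.sub_apply, Function.comp]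
    ring
  simp only [id] at hlim ⊢
  have hH0 : Tendsto (fun R => H R - H (-R)) atTop (nhds 0) := by
    have hb := tendsto_gaussianPDFReal_std_atTop.const_mul (2 * a)
    rw [mul_zero] at hb
    refine squeeze_zero_norm (fun R => ?_) hb
    have hp := gaussianPDFReal_nonneg 0 1 R
    have h1 := abs_le.1 (abs_eta_le ha γ (t * R))
    have h2 := abs_le.1 (abs_eta_le ha γ (t * -R))
    simp only [hH, gaussianPDFReal_std_neg, Real.norm_eq_abs]
    rw [abs_le]
    constructor <;> nlinarith
  exact hH0.congr fun R => (hFTC R).symm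

lemma residual_mul_sub_ge {a b γ x y : ℝ} (ha : 0 ≤ a) (hγ : 0 < 1 + γ) (hy : |y| ≤ b) :
    -(|(1 + γ) * eta a γ x - x| * (b - a)) ≤ ((1 + γ) * eta a γ x - x) * (y - eta a γ x) := by
  rw [abs_le] at hy
  have hx : x = (1 + γ) * (x / (1 + γ)) := by field_simp
  rcases le_total a (x / (1 + γ)) with h | h
  · have he : eta a γ x = a := by
      simp only [eta, min_eq_left h]
      exact max_eq_right (by linarith)
    have hw : (1 + γ) * a - x ≤ 0 := by nlinarith
    rw [he, abs_of_nonpos hw]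
    nlinarith
  rcases le_total (x / (1 + γ)) (-a) with h' | h'
  · have he : eta a γ x = -a := by
      simp only [eta, min_eq_right h]
      exact max_eq_left h'
    have hw : 0 ≤ (1 + γ) * -a - x := by nlinarith
    rw [he, abs_of_nonneg hw]
    nlinarith
  · have he : eta a γ x = x / (1 + γ) := by
      simp only [eta, min_eq_right h]
      exact max_eq_right h'
    rw [he, ← hx]
    simp

lemma supporting_inequality {δ ρ γ t t2 s d a b A B C U V N E : ℝ} (hδ : 0 < δ) (hρ : 0 < ρ)
    (hγ : 0 < γ) (ht : 0 < t) (hs : 0 ≤ s) (htt : t ^ 2 = t2) (hA : t2 = 1 + δ⁻¹ * A)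
    (hE : ρ = γ * (1 - δ⁻¹ * E)) (hU : U = t * E) (hC : 1 + δ⁻¹ * C ≤ s ^ 2)
    (hd : s - δ⁻¹ * V ≤ d)
    (hquad : ∀ p q : ℝ, 0 ≤ p ^ 2 * C - 2 * p * q * B + q ^ 2 * A)
    (hkkt : -(N * (b - a)) ≤ (1 + γ) * B - t * V - (1 + γ) * A + t * U) :
    δ * ρ * (t2 - 1) + δ * ρ ^ 2 * t2 / γ ^ 2 - 2 * ρ / γ * N * (b - a) ≤ δ * d ^ 2 + ρ * C := by
  obtain ⟨r, hr⟩ : ∃ r, r = ρ / γ := ⟨_, rfl⟩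
  have hrpos : 0 < r := hr ▸ div_pos hρ hγ
  have hρr : ρ = r * γ := by rw [hr]; field_simp
  have hA' : A = δ * (t ^ 2 - 1) := by rw [htt, hA]; field_simp; ring
  have hE' : E = δ * (1 - r) := by
    rw [hr, hE]; field_simp; ring
  have hU' : U = δ * t * (1 - r) := by rw [hU, hE']; ring
  have hC' : C ≤ δ * (s ^ 2 - 1) := by
    have := mul_le_mul_of_nonneg_left hC hδ.le
    have h2 : δ * (1 + δ⁻¹ * C) = δ + C := by field_simp
    linarith
  have hd' : δ * s - V ≤ δ * d := by
    have := mul_le_mul_of_nonneg_left hd hδ.le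
    have h2 : δ * (s - δ⁻¹ * V) = δ * s - V := by field_simp
    linarith
  have hC0 : 0 ≤ C := by simpa using hquad 1 0
  have hspos : 0 < s := by
    rcases hs.eq_or_lt with h | h
    · rw [← h] at hC'; nlinarith
    · exact h
  have hB : δ + B ≤ δ * (s * t) := by
    have h1 := hquad t s
    have h2 : t ^ 2 * C ≤ t ^ 2 * (δ * (s ^ 2 - 1)) := by gcongr
    have h3 : 0 ≤ δ * (s - t) ^ 2 := by positivity
    have h4 : 0 < s * t := by positivity
    rw [hA'] at h1
    refine le_of_mul_le_mul_left ?_ h4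
    linarith
  have hq := hquad 1 1
  have hsq : 0 ≤ δ * (d - t * r) ^ 2 := by positivity
  have hc : 2 * (t * r) * (δ * s - V) ≤ 2 * (t * r) * (δ * d) := by gcongr
  have hB' : 2 * r * (δ + B) ≤ 2 * r * (δ * (s * t)) := by gcongr
  have hk := mul_le_mul_of_nonneg_left hkkt (show 0 ≤ 2 * r by positivity)
  have hρq := mul_le_mul_of_nonneg_left hq hρ.le
  have e1 : δ * ρ ^ 2 * t2 / γ ^ 2 = δ * t ^ 2 * r ^ 2 := by rw [hr, htt]; field_simp
  have e2 : 2 * ρ / γ * N * (b - a) = 2 * r * (N * (b - a)) := by rw [hr]; ring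
  rw [e1, e2, ← htt]
  rw [hU', hA'] at hk
  rw [hA'] at hρq
  rw [hρr] at hρq ⊢
  linarith

/-- The fixed point at `a` yields a supporting line, in the size `b` of the constraint, for the
scalarised objective `δ (√(1 + E[Y²]/δ) − E[ZY]/δ)₊² + ρ E[Y²]` over `|Y| ≤ b`. -/
lemma IsSEFixedPoint.exists_supporting_slope {δ ρ a t2 γ : ℝ} (hδ : 0 < δ) (hρ : 0 < ρ)
    (ha : 0 ≤ a) (h : IsSEFixedPoint δ ρ a (t2, γ)) :
    ∃ M : ℝ, ∀ (b s d : ℝ) (Y : ℝ → ℝ), Measurable Y → (∀ z, |Y z| ≤ b) → 0 ≤ s →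
      1 + δ⁻¹ * ∫ z, Y z ^ 2 ∂stdGaussian ≤ s ^ 2 →
      s - δ⁻¹ * ∫ z, z * Y z ∂stdGaussian ≤ d →
      δ * ρ * (t2 - 1) + δ * ρ ^ 2 * t2 / γ ^ 2 - M * (b - a) ≤
        δ * d ^ 2 + ρ * ∫ z, Y z ^ 2 ∂stdGaussian := by
  obtain ⟨ht1, hγ, hfix, hfix'⟩ := h
  simp only at ht1 hγ hfix hfix'
  set t := √t2 with ht
  have htt : t ^ 2 = t2 := Real.sq_sqrt (by linarith)
  have htpos : 0 < t := Real.sqrt_pos.2 (by linarith)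
  set X : ℝ → ℝ := fun z => eta a γ (t * z) with hXdef
  have hXm : Measurable X := (continuous_eta a γ).measurable.comp (by fun_prop)
  have hXa : ∀ z, |X z| ≤ a := fun z => abs_eta_le ha γ _
  have hstein := integral_mul_eta (γ := γ) ha (by linarith) htpos
  have hiX := integrable_of_abs_le hXm hXa
  have hiXX : Integrable (fun z => X z * X z) stdGaussian := integrable_mul_of_abs_le hXm hXa hiX
  have hiZX : Integrable (fun z => z * X z) stdGaussian :=
    integrable_mul_of_abs_le hXm hXa integrable_id_stdGaussian
  have hiW : Integrable (fun z => |(1 + γ) * X z - t * z|) stdGaussian :=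
    ((hiX.const_mul (1 + γ)).sub (integrable_id_stdGaussian.const_mul t)).abs
  refine ⟨2 * ρ / γ * ∫ z, |(1 + γ) * X z - t * z| ∂stdGaussian, ?_⟩
  intro b s d Y hYm hYb hs hsY hd
  have hiY := integrable_of_abs_le hYm hYb
  have hiYY : Integrable (fun z => Y z * Y z) stdGaussian := integrable_mul_of_abs_le hYm hYb hiY
  have hiXY : Integrable (fun z => X z * Y z) stdGaussian := integrable_mul_of_abs_le hYm hYb hiX
  have hiZY : Integrable (fun z => z * Y z) stdGaussian :=
    integrable_mul_of_abs_le hYm hYb integrable_id_stdGaussian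
  have hquad : ∀ p q : ℝ, 0 ≤ p ^ 2 * ∫ z, Y z * Y z ∂stdGaussian -
      2 * p * q * ∫ z, X z * Y z ∂stdGaussian + q ^ 2 * ∫ z, X z * X z ∂stdGaussian := by
    intro p q
    rw [← integral_const_mul, ← integral_const_mul, ← integral_const_mul,
      ← integral_sub (hiYY.const_mul _) (hiXY.const_mul _),
      ← integral_add (f := fun z => p ^ 2 * (Y z * Y z) - 2 * p * q * (X z * Y z))
        ((hiYY.const_mul _).sub (hiXY.const_mul _)) (hiXX.const_mul _)]
    refine integral_nonneg fun z => ?_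
    have := sq_nonneg (p * Y z - q * X z)
    simp only [Pi.zero_apply]
    linarith
  have hkkt : -((∫ z, |(1 + γ) * X z - t * z| ∂stdGaussian) * (b - a)) ≤
      (1 + γ) * ∫ z, X z * Y z ∂stdGaussian - t * ∫ z, z * Y z ∂stdGaussian
        - (1 + γ) * ∫ z, X z * X z ∂stdGaussian + t * ∫ z, z * X z ∂stdGaussian := by
    rw [← integral_mul_const, ← integral_neg, ← integral_const_mul, ← integral_const_mul,
      ← integral_const_mul, ← integral_const_mul,
      ← integral_sub (hiXY.const_mul _) (hiZY.const_mul _),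
      ← integral_sub (f := fun z => (1 + γ) * (X z * Y z) - t * (z * Y z))
        ((hiXY.const_mul _).sub (hiZY.const_mul _)) (hiXX.const_mul _),
      ← integral_add (f := fun z => (1 + γ) * (X z * Y z) - t * (z * Y z) -
          (1 + γ) * (X z * X z))
        (((hiXY.const_mul _).sub (hiZY.const_mul _)).sub (hiXX.const_mul _)) (hiZX.const_mul _)]
    refine integral_mono (hiW.mul_const _).neg ((((hiXY.const_mul _).sub
      (hiZY.const_mul _)).sub (hiXX.const_mul _)).add (hiZX.const_mul _)) fun z => ?_
    have := residual_mul_sub_ge (x := t * z) ha (show 0 < 1 + γ by linarith) (hYb z)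
    simp only [hXdef]
    linarith
  have hXX : ∫ z, eta a γ (t * z) ^ 2 ∂stdGaussian = ∫ z, X z * X z ∂stdGaussian := by
    simp only [hXdef, sq]
  have hYY : ∫ z, Y z ^ 2 ∂stdGaussian = ∫ z, Y z * Y z ∂stdGaussian := by simp only [sq]
  rw [hXX] at hfix
  rw [hYY] at hsY ⊢
  change ∫ z, z * X z ∂stdGaussian = _ at hstein
  generalize (∫ z, X z * X z ∂stdGaussian) = A at *
  generalize (∫ z, X z * Y z ∂stdGaussian) = B at *
  generalize (∫ z, Y z * Y z ∂stdGaussian) = C at *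
  generalize (∫ z, z * X z ∂stdGaussian) = U at *
  generalize (∫ z, z * Y z ∂stdGaussian) = V at *
  generalize (∫ z, |(1 + γ) * X z - t * z| ∂stdGaussian) = N at *
  generalize (∫ z, eta' a γ (t * z) ∂stdGaussian) = E at *
  exact supporting_inequality hδ hρ hγ htpos hs htt hfix hfix' hstein hsY hd hquad hkkt

lemma exists_minimizer_of_supporting_slopes {g : ℝ → ℝ} {lam : ℝ} (hlam : 0 < lam)
    (hg0 : ∀ a, 0 ≤ a → 0 ≤ g a)
    (hg : ∀ a, 0 ≤ a → ∃ M : ℝ, ∀ b, 0 ≤ b → g a - M * (b - a) ≤ g b) :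
    ∃ x, 0 ≤ x ∧ (∀ a, 0 ≤ a → g x + lam * x ^ 2 ≤ g a + lam * a ^ 2) ∧
      ∀ b, 0 ≤ b → (∀ a, 0 ≤ a → g b + lam * b ^ 2 ≤ g a + lam * a ^ 2) → b = x := by
  have hlsc : LowerSemicontinuousOn (fun a => g a + lam * a ^ 2) (Set.Ici 0) := by
    intro a ha y hy
    obtain ⟨M, hM⟩ := hg a ha
    have hcont : Continuous fun b => g a - M * (b - a) + lam * b ^ 2 := by fun_prop
    have hya : y < g a - M * (a - a) + lam * a ^ 2 := by simpa using hy
    filter_upwards [nhdsWithin_le_nhds (hcont.continuousAt.eventually (lt_mem_nhds hya)),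
      self_mem_nhdsWithin] with b hb hb0
    linarith [hM b hb0]
  obtain ⟨R, hR0, hR⟩ : ∃ R : ℝ, 0 ≤ R ∧ ∀ a, R ≤ a → g 0 ≤ lam * a ^ 2 := by
    have h0 := hg0 0 le_rfl
    refine ⟨g 0 / lam + 1, by positivity, fun a ha => ?_⟩
    have h1 : g 0 = lam * (g 0 / lam) := by field_simp
    have h2 : 0 ≤ g 0 / lam := by positivity
    rw [h1]
    gcongr
    nlinarith
  obtain ⟨x, hx, hmin⟩ := (hlsc.mono fun a (ha : a ∈ Set.Icc 0 R) => ha.1).exists_isMinOn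
    (Set.nonempty_Icc.2 hR0) isCompact_Icc
  have hxmin : ∀ a, 0 ≤ a → g x + lam * x ^ 2 ≤ g a + lam * a ^ 2 := by
    intro a ha
    rcases le_total a R with h | h
    · exact hmin ⟨ha, h⟩
    · have h0 : g x + lam * x ^ 2 ≤ g 0 + lam * 0 ^ 2 := hmin ⟨le_rfl, hR0⟩
      linarith [hR a h, hg0 a ha]
  refine ⟨x, hx.1, hxmin, fun b hb hbmin => ?_⟩
  by_contra hne
  have hm : 0 ≤ (b + x) / 2 := by linarith [hx.1]
  obtain ⟨M, hM⟩ := hg _ hm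
  have h1 := hM b hb
  have h2 := hM x hx.1
  have h3 := hbmin _ hm
  have h4 := hxmin _ hm
  have h5 : 0 < lam * (b - x) ^ 2 := mul_pos hlam (sq_pos_of_ne_zero (sub_ne_zero.2 hne))
  linarith

lemma integral_abs_stdGaussian_pos : 0 < ∫ z, |z| ∂stdGaussian := by
  have : NullSingletonClass _root_.stdGaussian := nullSingletonClass_gaussianReal one_ne_zero
  rw [integral_pos_iff_support_of_nonneg (fun z => abs_nonneg z) integrable_id_stdGaussian.abs]
  have hsupp : Function.support (fun z : ℝ => |z|) = {0}ᶜ := by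
    ext z
    simp
  rw [hsupp, prob_compl_eq_one_sub (measurableSet_singleton 0), measure_singleton]
  simp

lemma IsSEFixedPoint.zero {δ ρ t2 γ : ℝ} (h : IsSEFixedPoint δ ρ 0 (t2, γ)) :
    t2 = 1 ∧ γ = ρ := by
  obtain ⟨-, -, h1, h2⟩ := h
  have heta : ∀ x, eta 0 γ x = 0 := fun x => abs_nonpos_iff.1 (abs_eta_le le_rfl γ x)
  have heta' : ∀ x, eta' 0 γ x = 0 := fun x => by simp [eta', (abs_nonneg x).not_gt]
  simp only [heta, heta'] at h1 h2
  simp at h1 h2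
  exact ⟨h1, h2.symm⟩

/-- Lemma 2, second part. For `δ > 0`, `ρ > 0`, `λ > 0`, the function
`f(a) = δρ(τ_a² − 1) + δρ²τ_a²/γ_a² + λa²` attains a unique minimizer `a*` over `[0, ∞)`,
and `a* > 0`. Here, for each `a ≥ 0`, `(τ_a², γ_a)` is the unique solution of the
state-evolution fixed-point equations. -/
theorem fLim_unique_positive_minimizer (δ ρ lam : ℝ) (hδ : 0 < δ) (hρ : 0 < ρ) (hlam : 0 < lam)
    (τ2 γv : ℝ → ℝ)
    (hSE : ∀ a, 0 ≤ a → IsSEFixedPoint δ ρ a (τ2 a, γv a))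
    (hSEuniq : ∀ a, 0 ≤ a → ∀ p : ℝ × ℝ, IsSEFixedPoint δ ρ a p → p = (τ2 a, γv a)) :
    ∃ astar : ℝ, 0 < astar ∧
      (∀ a, 0 ≤ a → fLim δ ρ lam τ2 γv astar ≤ fLim δ ρ lam τ2 γv a) ∧
      (∀ b, 0 ≤ b → (∀ a, 0 ≤ a → fLim δ ρ lam τ2 γv b ≤ fLim δ ρ lam τ2 γv a) →
        b = astar) := by
  have hslope := fun a ha => (hSE a ha).exists_supporting_slope hδ hρ ha
  have hslopes : ∀ a, 0 ≤ a → ∃ M : ℝ, ∀ b, 0 ≤ b →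
      δ * ρ * (τ2 a - 1) + δ * ρ ^ 2 * τ2 a / (γv a) ^ 2 - M * (b - a) ≤
        δ * ρ * (τ2 b - 1) + δ * ρ ^ 2 * τ2 b / (γv b) ^ 2 := by
    intro a ha
    obtain ⟨M, hM⟩ := hslope a ha
    refine ⟨M, fun b hb => ?_⟩
    obtain ⟨h1, h2, h3, h4⟩ := hSE b hb
    simp only at h1 h2 h3 h4
    have hpos : 0 < √(τ2 b) := Real.sqrt_pos.2 (by linarith)
    have hsq : √(τ2 b) ^ 2 = τ2 b := Real.sq_sqrt (by linarith)
    refine (hM b √(τ2 b) (√(τ2 b) * ρ / γv b) (fun z => eta b (γv b) (√(τ2 b) * z))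
      ((continuous_eta _ _).measurable.comp (by fun_prop)) (fun z => abs_eta_le hb _ _)
      hpos.le (by rw [hsq]; exact h3.ge) ?_).trans_eq ?_
    · rw [integral_mul_eta hb (by linarith) hpos]
      refine le_of_eq ?_
      rw [eq_div_iff h2.ne']
      linear_combination -√(τ2 b) * h4
    · have h5 : ∫ z, eta b (γv b) (√(τ2 b) * z) ^ 2 ∂stdGaussian = δ * (τ2 b - 1) := by
        rw [sub_eq_of_eq_add' h3]
        field_simp
      rw [h5, div_pow, mul_pow, hsq]
      ring
  obtain ⟨x, hx0, hxmin, hxuniq⟩ := exists_minimizer_of_supporting_slopes hlam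
    (g := fun a => δ * ρ * (τ2 a - 1) + δ * ρ ^ 2 * τ2 a / (γv a) ^ 2)
    (fun a ha => by
      have h1 : 1 ≤ τ2 a := (hSE a ha).1
      have h2 : 0 ≤ τ2 a - 1 := by linarith
      positivity) hslopes
  refine ⟨x, hx0.lt_of_ne fun h0 => ?_, hxmin, hxuniq⟩
  subst h0
  obtain ⟨ht0, hg0⟩ := (hSE 0 le_rfl).zero
  set c := ∫ z, |z| ∂stdGaussian with hc
  have hcpos : 0 < c := integral_abs_stdGaussian_pos
  set K := 1 + c ^ 2 / δ + ρ + lam with hK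
  have hK1 : 0 < K := by positivity
  obtain ⟨a, ha⟩ : ∃ a, a = c / K := ⟨_, rfl⟩
  have hapos : 0 < a := ha ▸ div_pos hcpos hK1
  have haK : a * K = c := by rw [ha]; field_simp
  obtain ⟨M, hM⟩ := hslope a hapos.le
  have hYY : ∫ z : ℝ, (if 0 ≤ z then a else -a) ^ 2 ∂stdGaussian = a ^ 2 := by
    have : ∀ z : ℝ, (if 0 ≤ z then a else -a) ^ 2 = a ^ 2 := fun z => by split_ifs <;> ring
    simp [this]
  have hZY : ∫ z : ℝ, z * (if 0 ≤ z then a else -a) ∂stdGaussian = a * c := by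
    rw [hc, ← integral_const_mul]
    congr 1 with z
    split_ifs with h
    · rw [abs_of_nonneg h]; ring
    · rw [abs_of_neg (not_le.1 h)]; ring
  have hbound := hM a (1 + a ^ 2 / (2 * δ)) (1 - a * c / (2 * δ)) (fun z => if 0 ≤ z then a else -a)
    (Measurable.ite measurableSet_Ici measurable_const measurable_const)
    (fun z => by split_ifs <;> simp [abs_of_pos hapos]) (by positivity)
    (by
      rw [hYY]
      have : 0 ≤ (a ^ 2 / (2 * δ)) ^ 2 := by positivity
      have e : δ⁻¹ * a ^ 2 = 2 * (a ^ 2 / (2 * δ)) := by field_simp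
      rw [e]
      linarith)
    (by
      rw [hZY]
      have e : δ⁻¹ * (a * c) = 2 * (a * c / (2 * δ)) := by field_simp
      have hac : a ≤ c := by
        rw [← haK]
        have : 1 ≤ K := by rw [hK]; linarith [show 0 ≤ c ^ 2 / δ by positivity]
        nlinarith
      have h2 : a ^ 2 / (2 * δ) ≤ a * c / (2 * δ) := by
        rw [sq]; gcongr
      rw [e]
      linarith)
  rw [hYY] at hbound
  have hmin := hxmin a hapos.le
  simp only [ht0, hg0] at hmin
  have e1 : δ * ρ ^ 2 * 1 / ρ ^ 2 = δ := by field_simp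
  have e2 : δ * (1 - a * c / (2 * δ)) ^ 2 = δ - a * c + a ^ 2 * (c ^ 2 / δ) / 4 := by
    field_simp; ring
  rw [e1] at hmin
  rw [e2] at hbound
  have h3 : a * c = a ^ 2 * (1 + c ^ 2 / δ + ρ + lam) := by rw [← hK, ← haK]; ring
  have h4 : 0 < a ^ 2 * (1 + (c ^ 2 / δ) * (3 / 4)) := by positivity
  linarith
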